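/- Suppose H is an 𝔽-free 3-graph on n vertices with ‖H‖₂ = ex_{ℓ2}(n, 𝔽). Then for every pair of vertices u, v ∈ V(H) one has |d_{2,H}(u) − d_{2,H}(v)| ≤ 60·n². Consequently, for every vertex v ∈ V(H), |d_{2,H}(v) − (1/n)·Σ_{u ∈ V(H)} d_{2,H}(u)| ≤ 60·n². -/

import Mathlib

/-- A 3-graph: every edge is a 3-element subset of the vertex set `Fin n`. -/
def Is3Graph {n : ℕ} (H : Finset (Finset (Fin n))) : Prop := ∀ e ∈ H, e.card = 3

/-- The shadow of a 3-graph: the pairs contained in at least one edge. -/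
def shadow3 {n : ℕ} (H : Finset (Finset (Fin n))) : Finset (Finset (Fin n)) :=
  Finset.univ.filter fun e => e.card = 2 ∧ ∃ E ∈ H, e ⊆ E

/-- The codegree of a pair `e`: the number of vertices `v` with `e ∪ {v} ∈ H`. -/
def codeg3 {n : ℕ} (H : Finset (Finset (Fin n))) (e : Finset (Fin n)) : ℕ :=
  (Finset.univ.filter fun v => v ∉ e ∧ insert v e ∈ H).card

/-- The ℓ2-norm of a 3-graph: `‖H‖₂ = ∑_{e ∈ ∂H} d_H(e)²`. -/
def l2norm {n : ℕ} (H : Finset (Finset (Fin n))) : ℕ :=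
  ∑ e ∈ shadow3 H, (codeg3 H e) ^ 2

/-- `H − v`: delete the vertex `v` and all edges containing it. -/
def delVert {n : ℕ} (H : Finset (Finset (Fin n))) (v : Fin n) : Finset (Finset (Fin n)) :=
  H.filter fun e => v ∉ e

/-- The ℓ2-norm degree of a vertex: `d_{2,H}(v) = ‖H‖₂ − ‖H − v‖₂`. -/
noncomputable def d2deg {n : ℕ} (H : Finset (Finset (Fin n))) (v : Fin n) : ℝ :=
  (l2norm H : ℝ) - (l2norm (delVert H v) : ℝ)
/-- The edges of the Fano plane, as a 3-graph on `Fin 7` (0-indexed version of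
the edge set {123, 345, 561, 174, 275, 376, 246}). -/
def fanoEdges : Finset (Finset (Fin 7)) :=
  {({0, 1, 2} : Finset (Fin 7)), {2, 3, 4}, {4, 5, 0}, {0, 6, 3}, {1, 6, 4}, {2, 6, 5}, {1, 3, 5}}

/-- A 3-graph is 𝔽-free if it contains no subgraph isomorphic to the Fano plane. -/
def FanoFree {n : ℕ} (H : Finset (Finset (Fin n))) : Prop :=
  ¬ ∃ f : Fin 7 → Fin n, Function.Injective f ∧ ∀ e ∈ fanoEdges, e.image f ∈ H
/-- `ex_{ℓ2}(n, 𝔽)`: the maximum ℓ2-norm over all 𝔽-free 3-graphs on `n` vertices. -/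
noncomputable def exL2 (n : ℕ) : ℕ :=
  sSup {m : ℕ | ∃ H : Finset (Finset (Fin n)), Is3Graph H ∧ FanoFree H ∧ l2norm H = m}

/-- The quadruples `((x, y), w, z)` such that both `{x, y, w}` and `{x, y, z}` are edges. -/
def edgePairs {n : ℕ} (H : Finset (Finset (Fin n))) :
    Finset ((Fin n × Fin n) × (Fin n × Fin n)) :=
  Finset.univ.filter fun t =>
    insert t.2.1 {t.1.1, t.1.2} ∈ H ∧ insert t.2.2 {t.1.1, t.1.2} ∈ H

lemma mem_edgePairs {n : ℕ} {H : Finset (Finset (Fin n))} {x y w z : Fin n} :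
    ((x, y), (w, z)) ∈ edgePairs H ↔ insert w {x, y} ∈ H ∧ insert z {x, y} ∈ H := by
  simp [edgePairs]

lemma Is3Graph.ne {n : ℕ} {H : Finset (Finset (Fin n))} (hH : Is3Graph H) {x y w : Fin n}
    (h : insert w {x, y} ∈ H) : x ≠ y ∧ w ∉ ({x, y} : Finset (Fin n)) := by
  have h3 := hH _ h
  constructor
  · rintro rfl
    have := Finset.card_insert_le w ({x, x} : Finset (Fin n))
    simp only [Finset.pair_eq_singleton, Finset.card_singleton] at this h3
    omega
  · intro hw
    rw [Finset.insert_eq_of_mem hw] at h3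
    have := Finset.card_le_two (a := x) (b := y)
    omega

lemma card_edgePairs {n : ℕ} {H : Finset (Finset (Fin n))} (hH : Is3Graph H) :
    (edgePairs H).card = 2 * l2norm H := by
  have hmaps : ∀ t ∈ edgePairs H, ({t.1.1, t.1.2} : Finset (Fin n)) ∈ shadow3 H := by
    rintro ⟨⟨x, y⟩, w, z⟩ ht
    rw [mem_edgePairs] at ht
    simp only [shadow3, Finset.mem_filter, Finset.mem_univ, true_and]
    exact ⟨Finset.card_pair (hH.ne ht.1).1, _, ht.1, Finset.subset_insert _ _⟩
  rw [Finset.card_eq_sum_card_fiberwise hmaps, l2norm, Finset.mul_sum]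
  refine Finset.sum_congr rfl fun e he => ?_
  simp only [shadow3, Finset.mem_filter, Finset.mem_univ, true_and] at he
  obtain ⟨a, b, hab, rfl⟩ := Finset.card_eq_two.1 he.1
  set N := Finset.univ.filter fun v => v ∉ ({a, b} : Finset (Fin n)) ∧ insert v {a, b} ∈ H with hN
  have hfib : (edgePairs H).filter (fun t => ({t.1.1, t.1.2} : Finset (Fin n)) = {a, b}) =
      ({(a, b), (b, a)} : Finset (Fin n × Fin n)) ×ˢ (N ×ˢ N) := by
    ext ⟨⟨x, y⟩, w, z⟩
    have hpair : (x, y) ∈ ({(a, b), (b, a)} : Finset (Fin n × Fin n)) ↔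
        x = a ∧ y = b ∨ x = b ∧ y = a := by simp
    simp only [Finset.mem_filter, mem_edgePairs, Finset.mem_product, hN, Finset.mem_univ, true_and,
      hpair]
    constructor
    · rintro ⟨⟨hw, hz⟩, he⟩
      have hxy := (hH.ne hw).1
      rw [he] at hw hz
      refine ⟨?_, ⟨(hH.ne hw).2, hw⟩, (hH.ne hz).2, hz⟩
      have hx : x ∈ ({a, b} : Finset (Fin n)) := by simp [← he]
      have hy : y ∈ ({a, b} : Finset (Fin n)) := by simp [← he]
      simp only [Finset.mem_insert, Finset.mem_singleton] at hx hy
      grind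
    · rintro ⟨h, ⟨-, hw⟩, -, hz⟩
      have he : ({x, y} : Finset (Fin n)) = {a, b} := by
        rcases h with ⟨rfl, rfl⟩ | ⟨rfl, rfl⟩
        · rfl
        · exact Finset.pair_comm _ _
      rw [he]
      exact ⟨⟨hw, hz⟩, rfl⟩
  have hne : (a, b) ≠ (b, a) := fun h => hab (Prod.mk.inj h).1
  rw [hfib, Finset.card_product, Finset.card_product, Finset.card_pair hne, sq]
  rfl

lemma Is3Graph.mono {n : ℕ} {G H : Finset (Finset (Fin n))} (hH : Is3Graph H) (h : G ⊆ H) :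
    Is3Graph G := fun e he => hH e (h he)

lemma edgePairs_mono {n : ℕ} {G H : Finset (Finset (Fin n))} (h : G ⊆ H) :
    edgePairs G ⊆ edgePairs H := by
  rintro ⟨⟨x, y⟩, w, z⟩
  simp only [mem_edgePairs]
  exact fun ht => ⟨h ht.1, h ht.2⟩

lemma edgePairs_inter {n : ℕ} (G H : Finset (Finset (Fin n))) :
    edgePairs (G ∩ H) = edgePairs G ∩ edgePairs H := by
  ext ⟨⟨x, y⟩, w, z⟩
  simp only [mem_edgePairs, Finset.mem_inter]
  tauto

lemma card_edgePairs_add_le {n : ℕ} (G H : Finset (Finset (Fin n))) :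
    (edgePairs G).card + (edgePairs H).card ≤
      (edgePairs (G ∪ H)).card + (edgePairs (G ∩ H)).card := by
  rw [← Finset.card_union_add_card_inter, edgePairs_inter]
  gcongr
  exact Finset.union_subset (edgePairs_mono Finset.subset_union_left)
    (edgePairs_mono Finset.subset_union_right)

lemma mem_delVert {n : ℕ} {H : Finset (Finset (Fin n))} {v : Fin n} {e : Finset (Fin n)} :
    e ∈ delVert H v ↔ e ∈ H ∧ v ∉ e :=
  Finset.mem_filter

lemma delVert_subset {n : ℕ} (H : Finset (Finset (Fin n))) (v : Fin n) : delVert H v ⊆ H :=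
  Finset.filter_subset _ _

/-- The 3-graph obtained from `H` by renaming the vertices along a permutation. -/
def renameVerts {n : ℕ} (σ : Equiv.Perm (Fin n)) (H : Finset (Finset (Fin n))) :
    Finset (Finset (Fin n)) :=
  H.image fun e => e.image σ

lemma card_edgePairs_le_renameVerts {n : ℕ} (σ : Equiv.Perm (Fin n)) (H : Finset (Finset (Fin n))) :
    (edgePairs H).card ≤ (edgePairs (renameVerts σ H)).card := by
  refine Finset.card_le_card_of_injOn (Prod.map (Prod.map σ σ) (Prod.map σ σ)) ?_
    (Function.Injective.injOn ((σ.injective.prodMap σ.injective).prodMap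
      (σ.injective.prodMap σ.injective)))
  rintro ⟨⟨x, y⟩, w, z⟩ ht
  rw [Finset.mem_coe, mem_edgePairs] at ht
  rw [Finset.mem_coe, Prod.map_apply, Prod.map_apply, Prod.map_apply, mem_edgePairs]
  exact ⟨Finset.mem_image.2 ⟨_, ht.1, by simp [Finset.image_insert]⟩,
    Finset.mem_image.2 ⟨_, ht.2, by simp [Finset.image_insert]⟩⟩

/-- The 3-graph obtained from `H` by replacing the vertex `v` with a copy of the vertex `u`. -/
def cloneVert {n : ℕ} (H : Finset (Finset (Fin n))) (u v : Fin n) : Finset (Finset (Fin n)) :=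
  delVert H v ∪ renameVerts (Equiv.swap u v) (delVert H v)

lemma notMem_of_mem_renameVerts_delVert {n : ℕ} {H : Finset (Finset (Fin n))} {u v : Fin n}
    {e : Finset (Fin n)} (he : e ∈ renameVerts (Equiv.swap u v) (delVert H v)) : u ∉ e := by
  obtain ⟨e', he', rfl⟩ := Finset.mem_image.1 he
  intro hu
  obtain ⟨x, hx, hxu⟩ := Finset.mem_image.1 hu
  have : x = v := by simpa using (Equiv.swap_apply_eq_iff.1 hxu)
  exact (mem_delVert.1 he').2 (this ▸ hx)

lemma Is3Graph.cloneVert {n : ℕ} {H : Finset (Finset (Fin n))} (hH : Is3Graph H) (u v : Fin n) :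
    Is3Graph (cloneVert H u v) := by
  intro e he
  rcases Finset.mem_union.1 he with he | he
  · exact hH e (delVert_subset H v he)
  · obtain ⟨e', he', rfl⟩ := Finset.mem_image.1 he
    rw [Finset.card_image_of_injective _ (Equiv.injective _)]
    exact hH e' (delVert_subset H v he')

lemma image_swap_of_notMem {n : ℕ} {u v : Fin n} {e : Finset (Fin n)} (hu : u ∉ e)
    (hv : v ∉ e) : e.image (Equiv.swap u v) = e := by
  conv_rhs => rw [← Finset.image_id (s := e)]
  refine Finset.image_congr fun x hx => ?_
  exact Equiv.swap_apply_of_ne_of_ne (fun h => hu (h ▸ hx)) (fun h => hv (h ▸ hx))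

lemma image_swap_mem_delVert {n : ℕ} {H : Finset (Finset (Fin n))} {u v : Fin n}
    {e : Finset (Fin n)} (he : e ∈ cloneVert H u v) (hu : u ∉ e) :
    e.image (Equiv.swap u v) ∈ delVert H v := by
  rcases Finset.mem_union.1 he with he | he
  · rwa [image_swap_of_notMem hu (mem_delVert.1 he).2]
  · obtain ⟨e', he', rfl⟩ := Finset.mem_image.1 he
    rw [Finset.image_image]
    have : (Equiv.swap u v : Fin n → Fin n) ∘ Equiv.swap u v = id := by
      ext x
      simp
    rwa [this, Finset.image_id]

lemma mem_delVert_of_mem_cloneVert {n : ℕ} {H : Finset (Finset (Fin n))} {u v : Fin n}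
    {e : Finset (Fin n)} (he : e ∈ cloneVert H u v) (hv : v ∉ e) : e ∈ delVert H v := by
  rcases Finset.mem_union.1 he with he | he
  · exact he
  · obtain ⟨e', he', rfl⟩ := Finset.mem_image.1 he
    have hu : u ∉ e' := fun hu => hv (Finset.mem_image.2 ⟨u, hu, Equiv.swap_apply_left u v⟩)
    rwa [image_swap_of_notMem hu (mem_delVert.1 he').2]

lemma exists_fanoEdges_mem_mem (i j : Fin 7) : ∃ e ∈ fanoEdges, i ∈ e ∧ j ∈ e := by
  revert i j
  decide

lemma FanoFree.cloneVert {n : ℕ} {H : Finset (Finset (Fin n))} (hF : FanoFree H) (u v : Fin n) :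
    FanoFree (cloneVert H u v) := by
  rintro ⟨f, hf, hfe⟩
  by_cases hu : ∃ i, f i = u
  · obtain ⟨i, rfl⟩ := hu
    by_cases hv : ∃ j, f j = v
    · obtain ⟨j, rfl⟩ := hv
      obtain ⟨e, he, hi, hj⟩ := exists_fanoEdges_mem_mem i j
      rcases Finset.mem_union.1 (hfe e he) with h | h
      · exact (mem_delVert.1 h).2 (Finset.mem_image_of_mem f hj)
      · exact notMem_of_mem_renameVerts_delVert h (Finset.mem_image_of_mem f hi)
    · refine hF ⟨f, hf, fun e he => ?_⟩
      refine delVert_subset H v (mem_delVert_of_mem_cloneVert (hfe e he) fun h => ?_)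
      obtain ⟨i, -, hi⟩ := Finset.mem_image.1 h
      exact hv ⟨i, hi⟩
  · refine hF ⟨Equiv.swap u v ∘ f, (Equiv.injective _).comp hf, fun e he => ?_⟩
    rw [← Finset.image_image]
    refine delVert_subset H v (image_swap_mem_delVert (hfe e he) fun h => ?_)
    obtain ⟨i, -, hi⟩ := Finset.mem_image.1 h
    exact hu ⟨i, hi⟩

lemma edgePairs_delVert {n : ℕ} (H : Finset (Finset (Fin n))) (v : Fin n) :
    edgePairs (delVert H v) = (edgePairs H).filter fun t =>
      ¬(t.1.1 = v ∨ t.1.2 = v ∨ t.2.1 = v ∨ t.2.2 = v) := by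
  ext ⟨⟨x, y⟩, w, z⟩
  simp only [mem_edgePairs, mem_delVert, Finset.mem_filter, Finset.mem_insert,
    Finset.mem_singleton]
  grind

/-- All quadruples in which `c` occurs at an earlier position than `d`. -/
def quadsThrough {n : ℕ} (c d : Fin n) : Finset ((Fin n × Fin n) × (Fin n × Fin n)) :=
  Finset.univ.image fun p : Fin 6 × Fin n × Fin n =>
    ![((c, d), (p.2.1, p.2.2)), ((c, p.2.1), (d, p.2.2)), ((c, p.2.1), (p.2.2, d)),
      ((p.2.1, c), (d, p.2.2)), ((p.2.1, c), (p.2.2, d)), ((p.2.1, p.2.2), (c, d))] p.1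

lemma card_quadsThrough_le {n : ℕ} (c d : Fin n) : (quadsThrough c d).card ≤ 6 * n ^ 2 := by
  refine Finset.card_image_le.trans_eq ?_
  simp [sq]

lemma mem_quadsThrough {n : ℕ} {c d x y w z : Fin n} :
    ((x, y), (w, z)) ∈ quadsThrough c d ↔
      (x = c ∧ (y = d ∨ w = d ∨ z = d)) ∨ (y = c ∧ (w = d ∨ z = d)) ∨ (w = c ∧ z = d) := by
  simp only [quadsThrough, Finset.mem_image, Finset.mem_univ, true_and, Prod.exists,
    Fin.exists_fin_succ]
  simp
  grind

lemma card_edgePairs_add_delVert_le {n : ℕ} (H : Finset (Finset (Fin n))) {u v : Fin n}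
    (huv : u ≠ v) :
    (edgePairs H).card + (edgePairs (delVert (delVert H v) u)).card ≤
      (edgePairs (delVert H u)).card + (edgePairs (delVert H v)).card + 12 * n ^ 2 := by
  have hinter : delVert (delVert H v) u = delVert H u ∩ delVert H v := by
    ext e
    simp only [mem_delVert, Finset.mem_inter]
    tauto
  have hsub : edgePairs H ⊆ (edgePairs (delVert H u) ∪ edgePairs (delVert H v)) ∪
      (quadsThrough u v ∪ quadsThrough v u) := by
    rintro ⟨⟨x, y⟩, w, z⟩ ht
    simp only [Finset.mem_union, edgePairs_delVert, Finset.mem_filter, ht, true_and,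
      mem_quadsThrough]
    grind
  have h1 := Finset.card_le_card hsub
  have h2 := Finset.card_union_le (edgePairs (delVert H u) ∪ edgePairs (delVert H v))
    (quadsThrough u v ∪ quadsThrough v u)
  have h3 := Finset.card_union_le (quadsThrough u v) (quadsThrough v u)
  have h4 := card_quadsThrough_le u v
  have h5 := card_quadsThrough_le v u
  have h6 := Finset.card_union_add_card_inter (edgePairs (delVert H u)) (edgePairs (delVert H v))
  rw [hinter, edgePairs_inter]
  omega

lemma two_mul_card_edgePairs_delVert_le {n : ℕ} (H : Finset (Finset (Fin n))) (u v : Fin n) :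
    2 * (edgePairs (delVert H v)).card ≤
      (edgePairs (cloneVert H u v)).card + (edgePairs (delVert (delVert H v) u)).card := by
  have h1 := card_edgePairs_add_le (delVert H v) (renameVerts (Equiv.swap u v) (delVert H v))
  have h2 := card_edgePairs_le_renameVerts (Equiv.swap u v) (delVert H v)
  have h3 : (edgePairs (delVert H v ∩ renameVerts (Equiv.swap u v) (delVert H v))).card ≤
      (edgePairs (delVert (delVert H v) u)).card := by
    refine Finset.card_le_card (edgePairs_mono fun e he => ?_)
    obtain ⟨h, h'⟩ := Finset.mem_inter.1 he
    exact mem_delVert.2 ⟨h, notMem_of_mem_renameVerts_delVert h'⟩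
  unfold cloneVert
  omega

lemma l2norm_le_exL2 {n : ℕ} {H : Finset (Finset (Fin n))} (hH : Is3Graph H) (hF : FanoFree H) :
    l2norm H ≤ exL2 n := by
  refine le_csSup ?_ ⟨H, hH, hF, rfl⟩
  refine ((Set.finite_range (l2norm (n := n))).subset ?_).bddAbove
  rintro m ⟨G, -, -, rfl⟩
  exact ⟨G, rfl⟩

lemma d2deg_eq {n : ℕ} {H : Finset (Finset (Fin n))} (hH : Is3Graph H) (v : Fin n) :
    2 * d2deg H v = (edgePairs H).card - (edgePairs (delVert H v)).card := by
  rw [card_edgePairs hH, card_edgePairs (hH.mono (delVert_subset H v)), d2deg]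
  push_cast
  ring

lemma d2deg_sub_le {n : ℕ} {H : Finset (Finset (Fin n))} (hH : Is3Graph H) (hF : FanoFree H)
    (hmax : l2norm H = exL2 n) (u v : Fin n) : d2deg H u - d2deg H v ≤ 6 * (n : ℝ) ^ 2 := by
  rcases eq_or_ne u v with rfl | huv
  · rw [sub_self]
    positivity
  have h1 := card_edgePairs_add_delVert_le H huv
  have h2 := two_mul_card_edgePairs_delVert_le H u v
  have h3 := l2norm_le_exL2 (hH.cloneVert u v) (hF.cloneVert u v)
  have h4 := card_edgePairs (hH.cloneVert u v)
  have h5 := card_edgePairs hH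
  have h6 : (edgePairs (delVert H v)).card ≤ (edgePairs (delVert H u)).card + 12 * n ^ 2 := by
    omega
  have h7 : ((edgePairs (delVert H v)).card : ℝ) ≤
      (edgePairs (delVert H u)).card + 12 * (n : ℝ) ^ 2 := by
    exact_mod_cast h6
  linarith [d2deg_eq hH u, d2deg_eq hH v]

/-- If H is an 𝔽-free 3-graph on n vertices with `‖H‖₂ = ex_{ℓ2}(n, 𝔽)`,
then any two ℓ2-norm degrees differ by at most 60·n², and every ℓ2-norm degree is within
60·n² of the average ℓ2-norm degree. -/
theorem extremal_near_regular (n : ℕ) (H : Finset (Finset (Fin n)))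
    (hH : Is3Graph H) (hF : FanoFree H) (hmax : l2norm H = exL2 n) :
    (∀ u v : Fin n, |d2deg H u - d2deg H v| ≤ 60 * (n : ℝ) ^ 2) ∧
    (∀ v : Fin n, |d2deg H v - (1 / (n : ℝ)) * ∑ u : Fin n, d2deg H u| ≤ 60 * (n : ℝ) ^ 2) := by
  have hdiff : ∀ u v : Fin n, |d2deg H u - d2deg H v| ≤ 60 * (n : ℝ) ^ 2 := by
    intro u v
    have huv := d2deg_sub_le hH hF hmax u v
    have hvu := d2deg_sub_le hH hF hmax v u
    rw [abs_le]
    constructor <;> nlinarith [sq_nonneg (n : ℝ)]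
  refine ⟨hdiff, fun v => ?_⟩
  have hn : (0 : ℝ) < n := by exact_mod_cast v.pos
  have havg : d2deg H v - (1 / (n : ℝ)) * ∑ u : Fin n, d2deg H u =
      (1 / (n : ℝ)) * ∑ u : Fin n, (d2deg H v - d2deg H u) := by
    rw [Finset.sum_sub_distrib, Finset.sum_const, Finset.card_univ, Fintype.card_fin, nsmul_eq_mul]
    field_simp
  rw [havg, abs_mul, abs_of_pos (one_div_pos.2 hn)]
  have hsum : |∑ u : Fin n, (d2deg H v - d2deg H u)| ≤ n * (60 * (n : ℝ) ^ 2) := by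
    refine (Finset.abs_sum_le_sum_abs _ _).trans ?_
    refine (Finset.sum_le_card_nsmul _ _ _ fun u _ => hdiff v u).trans_eq ?_
    rw [Finset.card_univ, Fintype.card_fin, nsmul_eq_mul]
  calc 1 / (n : ℝ) * |∑ u : Fin n, (d2deg H v - d2deg H u)|
      ≤ 1 / (n : ℝ) * (n * (60 * (n : ℝ) ^ 2)) := by gcongr
    _ = 60 * (n : ℝ) ^ 2 := by field_simp
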